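/- (Carré) Let S be an idempotent semiring with zero 0 and unity 1, let A be a semi-definite n×n matrix over S, B an n×s matrix over S, and set A* = ⊕_{l=0}^{n−1} A^l. Let X_0 be any n×s matrix with X_0 ≼ A*B (entrywise), and define X_{k+1} = A X_k ⊕ B for k ≥ 0. Then X_k = A*B for all k ≥ n; in particular the iterative process stabilizes to the minimal solution X = A*B of the equation X = AX ⊕ B after at most n iterations. -/

import Mathlib

/-- Canonical partial order on an idempotent semiring: `x ≼ y` iff `x ⊕ y = y`. -/
def sle {S : Type*} [Add S] (x y : S) : Prop := x + y = y

/-- Entrywise canonical order on matrices. -/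
def mle {S : Type*} [Add S] {m k : ℕ} (A B : Matrix (Fin m) (Fin k) S) : Prop :=
  ∀ i j, sle (A i j) (B i j)

/-- A square matrix over an idempotent semiring is semi-definite if the weight of
every closed path is `≼ 1`. -/
def IsSemiDefinite {S : Type*} [Semiring S] {n : ℕ} (A : Matrix (Fin n) (Fin n) S) : Prop :=
  ∀ (k : ℕ) (p : ℕ → Fin n), 1 ≤ k → p 0 = p k →
    sle (((List.range k).map (fun t => A (p t) (p (t + 1)))).prod) 1

/-- The closure `M* = ⊕_{k=0}^{n-1} M^k` of an `n × n` matrix. -/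
def mstar {S : Type*} [Semiring S] {n : ℕ} (M : Matrix (Fin n) (Fin n) S) :
    Matrix (Fin n) (Fin n) S :=
  ∑ l ∈ Finset.range n, M ^ l

/-- The weight of the path formed by the first `k` steps of `p`. -/
def pathWeight {S : Type*} [Semiring S] {n : ℕ} (A : Matrix (Fin n) (Fin n) S)
    (p : ℕ → Fin n) (k : ℕ) : S :=
  ((List.range k).map (fun t => A (p t) (p (t + 1)))).prod

theorem pathWeight_add {S : Type*} [Semiring S] {n : ℕ} (A : Matrix (Fin n) (Fin n) S)
    (p : ℕ → Fin n) (k l : ℕ) :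
    pathWeight A p (k + l) = pathWeight A p k * pathWeight A (fun t => p (k + t)) l := by
  simp [pathWeight, List.range_add, Function.comp_def, add_assoc]

section IdemSemiring

variable {S : Type*} [IdemSemiring S] {n : ℕ}

theorem pathWeight_le_pow_apply (A : Matrix (Fin n) (Fin n) S) (p : ℕ → Fin n) (k : ℕ) :
    pathWeight A p k ≤ (A ^ k) (p 0) (p k) := by
  induction k with
  | zero => simp [pathWeight]
  | succ k ih =>
    have h : pathWeight A p (k + 1) = pathWeight A p k * A (p k) (p (k + 1)) := by
      simp [pathWeight, List.range_succ]
    rw [h, pow_succ, Matrix.mul_apply]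
    exact (mul_le_mul' ih le_rfl).trans
      (Finset.single_le_sum (f := fun m => (A ^ k) (p 0) m * A m (p (k + 1)))
        (fun _ _ => zero_le) (Finset.mem_univ (p k)))

theorem mul_pow_apply_le_of_forall_pathWeight (A : Matrix (Fin n) (Fin n) S) (k : ℕ)
    (i j : Fin n) (u c : S)
    (h : ∀ p : ℕ → Fin n, p 0 = i → p k = j → u * pathWeight A p k ≤ c) :
    u * (A ^ k) i j ≤ c := by
  induction k generalizing i u with
  | zero =>
    by_cases hij : i = j
    · simpa [hij, pathWeight] using h (fun _ => i) rfl hij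
    · simp [Matrix.one_apply_ne hij]
  | succ k ih =>
    rw [pow_succ', Matrix.mul_apply, Finset.mul_sum]
    refine Finset.sum_induction _ (· ≤ c) (fun _ _ => add_le) zero_le fun m _ => ?_
    rw [← mul_assoc]
    refine ih m (u * A i m) fun p hp0 hpk => ?_
    have hp := h (fun t => Nat.casesOn t i p) rfl hpk
    rw [add_comm k 1, pathWeight_add] at hp
    simpa [pathWeight, hp0, mul_assoc, Nat.add_comm 1] using hp

/-- A path of length `n` on `n` vertices repeats a vertex, and the cycle can be removed. -/
theorem pathWeight_le_sum_pow (A : Matrix (Fin n) (Fin n) S)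
    (hA : ∀ (k : ℕ) (p : ℕ → Fin n), 1 ≤ k → p 0 = p k → pathWeight A p k ≤ 1)
    (p : ℕ → Fin n) :
    pathWeight A p n ≤ ∑ l ∈ Finset.range n, (A ^ l) (p 0) (p n) := by
  obtain ⟨a, b, hab, hbn, hpab⟩ : ∃ a b, a < b ∧ b ≤ n ∧ p a = p b := by
    obtain ⟨x, y, hxy, hp⟩ := Fintype.exists_ne_map_eq_of_card_lt
      (fun t : Fin (n + 1) => p t) (by simp)
    rcases lt_or_gt_of_ne hxy with h | h
    · exact ⟨x, y, h, Nat.lt_succ_iff.mp y.2, hp⟩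
    · exact ⟨y, x, h, Nat.lt_succ_iff.mp x.2, hp.symm⟩
  obtain ⟨d, rfl⟩ := Nat.exists_eq_add_of_lt hab
  obtain ⟨e, he⟩ := Nat.exists_eq_add_of_le hbn
  have hsplit : pathWeight A p n = pathWeight A p a *
      pathWeight A (fun t => p (a + t)) (d + 1) *
      pathWeight A (fun t => p (a + d + 1 + t)) e := by
    rw [congrArg (pathWeight A p) he, pathWeight_add, add_assoc a d 1, pathWeight_add]
  have hcycle : pathWeight A (fun t => p (a + t)) (d + 1) ≤ 1 :=
    hA _ _ (Nat.le_add_left 1 d) (by simpa [add_assoc] using hpab)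
  have htail : pathWeight A (fun t => p (a + d + 1 + t)) e ≤ (A ^ e) (p a) (p n) := by
    have := pathWeight_le_pow_apply A (fun t => p (a + d + 1 + t)) e
    simpa only [add_zero, ← hpab, ← he] using this
  calc pathWeight A p n
      ≤ (A ^ a) (p 0) (p a) * 1 * (A ^ e) (p a) (p n) := by
        rw [hsplit]
        exact mul_le_mul' (mul_le_mul' (pathWeight_le_pow_apply A p a) hcycle) htail
    _ ≤ (A ^ (a + e)) (p 0) (p n) := by
        rw [mul_one, pow_add, Matrix.mul_apply]
        exact Finset.single_le_sum (f := fun m => (A ^ a) (p 0) m * (A ^ e) m (p n))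
          (fun _ _ => zero_le) (Finset.mem_univ (p a))
    _ ≤ _ := Finset.single_le_sum (f := fun l => (A ^ l) (p 0) (p n))
          (fun _ _ => zero_le) (Finset.mem_range.mpr (by omega))

end IdemSemiring

theorem pow_add_mstar {S : Type*} [Semiring S] (hid : ∀ x : S, x + x = x) {n : ℕ}
    (A : Matrix (Fin n) (Fin n) S) (hA : IsSemiDefinite A) :
    A ^ n + mstar A = mstar A := by
  let _ : IdemSemiring S := IdemSemiring.ofSemiring hid
  ext i j
  rw [Matrix.add_apply, mstar, Matrix.sum_apply]
  refine add_eq_right_iff_le.mpr ?_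
  rw [← one_mul ((A ^ n) i j)]
  refine mul_pow_apply_le_of_forall_pathWeight A n i j 1 _ fun p hi hj => ?_
  rw [one_mul, ← hi, ← hj]
  exact pathWeight_le_sum_pow A
    (fun k q hk hq => add_eq_right_iff_le.mp (hA k q hk hq)) p

theorem mul_mstar_add_one {S : Type*} [Semiring S] (hid : ∀ x : S, x + x = x) {n : ℕ}
    (A : Matrix (Fin n) (Fin n) S) (hA : IsSemiDefinite A) :
    A * mstar A + 1 = mstar A := by
  conv_rhs => rw [← pow_add_mstar hid A hA]
  rw [mstar, ← geom_sum_succ, geom_sum_succ']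

theorem sum_range_pow_eq_mstar {S : Type*} [Semiring S] (hid : ∀ x : S, x + x = x) {n : ℕ}
    (A : Matrix (Fin n) (Fin n) S) (hA : IsSemiDefinite A) {k : ℕ} (hk : n ≤ k) :
    ∑ l ∈ Finset.range k, A ^ l = mstar A := by
  induction k, hk using Nat.le_induction with
  | base => rfl
  | succ k _ ih => rw [geom_sum_succ, ih, mul_mstar_add_one hid A hA]

/-- Carré: for a semi-definite `n × n` matrix `A` over an idempotent
semiring with zero and unity, the iterative process `X_{k+1} = A X_k ⊕ B` started at
any `X_0 ≼ A*B` stabilizes to the minimal solution `A*B` of `X = AX ⊕ B` after at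
most `n` iterations: `X_k = A*B` for all `k ≥ n`. -/
theorem carre_iteration {S : Type*} [Semiring S]
    (hid : ∀ x : S, x + x = x)
    {n s : ℕ}
    (A : Matrix (Fin n) (Fin n) S) (hA : IsSemiDefinite A)
    (B : Matrix (Fin n) (Fin s) S)
    (X : ℕ → Matrix (Fin n) (Fin s) S)
    (hX0 : mle (X 0) (mstar A * B))
    (hXrec : ∀ k : ℕ, X (k + 1) = A * X k + B) :
    ∀ k : ℕ, n ≤ k → X k = mstar A * B := by
  have hidB : B + B = B := Matrix.ext fun i j => hid (B i j)
  have hfix : A * (mstar A * B) + B = mstar A * B := by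
    conv_rhs => rw [← mul_mstar_add_one hid A hA, Matrix.add_mul, Matrix.one_mul,
      Matrix.mul_assoc]
  have hupper : ∀ k, X k + mstar A * B = mstar A * B := by
    intro k
    induction k with
    | zero => exact Matrix.ext hX0
    | succ k ih =>
      calc X (k + 1) + mstar A * B
          = (A * X k + B) + (A * (mstar A * B) + B) := by rw [hXrec, hfix]
        _ = A * (X k + mstar A * B) + B := by
            rw [add_add_add_comm, hidB, Matrix.mul_add]
        _ = mstar A * B := by rw [ih, hfix]
  have hlower : ∀ k, (∑ l ∈ Finset.range k, A ^ l) * B + X k = X k := by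
    intro k
    induction k with
    | zero => simp
    | succ k ih =>
      rw [geom_sum_succ, hXrec, Matrix.add_mul, Matrix.one_mul, Matrix.mul_assoc,
        add_add_add_comm, hidB, ← Matrix.mul_add, ih]
  intro k hk
  rw [← hlower k, sum_range_pow_eq_mstar hid A hA hk, add_comm, hupper]
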